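/- arXiv:2003.05135 — 2 statements merged into one kernel-verified Lean document; each statement's English description precedes it below -/
import Mathlib

section
/- Let λ, μ₁, μ₂ > 0 with μ₁ < 2μ₂, set p = λ/(λ + μ₂) and p̄ = 1 − p, let π_J ∈ [0,1] with π̄_J = 1 − π_J, let S ≥ 1 be an integer and Q : {0,…,S} → [0,∞) with Σ_{s=0}^S Q(s) = 1, generating function 𝒢_Q(z) = Σ_{s=0}^S z^s Q(s), and Q̄(0) = 1 − Q(0). With g₁(x) = μ₁e^{−μ₁x} and h_s(x) = μ₂^s x^{s−1} e^{−μ₂x}/(s−1)!, define Φ₁(x) = p π_J (g₁*h₁)(x)/g₁(x), Φ₂(x) = p π_J Σ_{s=2}^S ((g₁*h_s)(x)/g₁(x)) Σ_{l=s}^S Q(l) p̄^{l−s} + π̄_J Σ_{s=1}^S ((g₁*h_s)(x)/g₁(x)) Q(s), Δ₁(q) = ((1−q)/(1 − qp̄))·((1−q) + q𝒢_Q(p̄))·π_J + (1 − qQ̄(0))·π̄_J, Δ₂(q) = q·(p̄(1 − qQ̄(0)) + 𝒢_Q(p̄) − Q(0))/(p̄(1 − qp̄)), and W(q,x) = Δ₁(q)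 + Δ₂(q)Φ₁(x) + qΦ₂(x). Then there exists a finite constant c₀ such that, as q → 0⁺, ∫₀^∞ μ₁ e^{−μ₁x} √(W(q,x)) dx = 1 + c₀q² + o(q²). -/
open MeasureTheory Real Set Filter
open scoped BigOperators

/-- `s`-stage Erlang density with rate `μ₂` per stage. -/
noncomputable def erlangDensity (μ₂ : ℝ) (s : ℕ) (x : ℝ) : ℝ :=
  μ₂ ^ s * x ^ (s - 1) * Real.exp (-μ₂ * x) / (Nat.factorial (s - 1))

/-- Convolution `(g₁ * h_s)(x)` of the exponential density `g₁` (rate `μ₁`)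
with the `s`-stage Erlang density `h_s` (rate `μ₂` per stage). -/
noncomputable def convExpErlang (μ₁ μ₂ : ℝ) (s : ℕ) (x : ℝ) : ℝ :=
  ∫ u in (0:ℝ)..x, (μ₁ * Real.exp (-μ₁ * u)) * erlangDensity μ₂ s (x - u)

/-- `Φ₁(x) = p π_J (g₁*h₁)(x)/g₁(x)` with `p = λ/(λ+μ₂)`. -/
noncomputable def Phi1 (lam μ₁ μ₂ πJ : ℝ) (x : ℝ) : ℝ :=
  (lam / (lam + μ₂)) * πJ *
    (convExpErlang μ₁ μ₂ 1 x / (μ₁ * Real.exp (-μ₁ * x)))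

/-- `Φ₂(x) = p π_J Σ_{s=2}^S ((g₁*h_s)(x)/g₁(x)) Σ_{l=s}^S Q(l) p̄^{l−s}
          + π̄_J Σ_{s=1}^S ((g₁*h_s)(x)/g₁(x)) Q(s)` with `p̄ = 1 − p`. -/
noncomputable def Phi2 (lam μ₁ μ₂ πJ : ℝ) (S : ℕ) (Q : ℕ → ℝ) (x : ℝ) : ℝ :=
  (lam / (lam + μ₂)) * πJ *
      ∑ s ∈ Finset.Icc 2 S,
        (convExpErlang μ₁ μ₂ s x / (μ₁ * Real.exp (-μ₁ * x))) *
          ∑ l ∈ Finset.Icc s S, Q l * (1 - lam / (lam + μ₂)) ^ (l - s)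
    + (1 - πJ) *
        ∑ s ∈ Finset.Icc 1 S,
          (convExpErlang μ₁ μ₂ s x / (μ₁ * Real.exp (-μ₁ * x))) * Q s

/-- Generating function `𝒢_Q(z) = Σ_{s=0}^S z^s Q(s)` of the batch distribution. -/
noncomputable def genQ (S : ℕ) (Q : ℕ → ℝ) (z : ℝ) : ℝ :=
  ∑ s ∈ Finset.range (S + 1), z ^ s * Q s

/-- `Δ₁(q) = ((1−q)/(1−qp̄))((1−q) + q𝒢_Q(p̄))π_J + (1 − q Q̄(0)) π̄_J`. -/
noncomputable def Delta1 (lam μ₂ πJ : ℝ) (S : ℕ) (Q : ℕ → ℝ) (q : ℝ) : ℝ :=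
  ((1 - q) / (1 - q * (1 - lam / (lam + μ₂)))) *
      ((1 - q) + q * genQ S Q (1 - lam / (lam + μ₂))) * πJ
    + (1 - q * (1 - Q 0)) * (1 - πJ)

/-- `Δ₂(q) = q (p̄(1 − q Q̄(0)) + 𝒢_Q(p̄) − Q(0)) / (p̄(1 − qp̄))`. -/
noncomputable def Delta2 (lam μ₂ : ℝ) (S : ℕ) (Q : ℕ → ℝ) (q : ℝ) : ℝ :=
  q * ((1 - lam / (lam + μ₂)) * (1 - q * (1 - Q 0))
        + genQ S Q (1 - lam / (lam + μ₂)) - Q 0)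
    / ((1 - lam / (lam + μ₂)) * (1 - q * (1 - lam / (lam + μ₂))))

/-- Likelihood ratio `W(q,x) = Δ₁(q) + Δ₂(q)Φ₁(x) + qΦ₂(x)`. -/
noncomputable def Wfun (lam μ₁ μ₂ πJ : ℝ) (S : ℕ) (Q : ℕ → ℝ) (q x : ℝ) : ℝ :=
  Delta1 lam μ₂ πJ S Q q + Delta2 lam μ₂ S Q q * Phi1 lam μ₁ μ₂ πJ x
    + q * Phi2 lam μ₁ μ₂ πJ S Q x

lemma abs_sqrt_sub_le (w : ℝ) : |√w - 1 - (w - 1) / 2| ≤ 2 * (w - 1) ^ 2 := by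
  rcases le_total 0 w with h | h
  · obtain ⟨s, hs, rfl⟩ : ∃ s : ℝ, 0 ≤ s ∧ w = s ^ 2 := ⟨√w, sqrt_nonneg w, (sq_sqrt h).symm⟩
    rw [sqrt_sq hs, show s - 1 - (s ^ 2 - 1) / 2 = -((s - 1) ^ 2 / 2) by ring, abs_neg,
      abs_of_nonneg (by positivity)]
    nlinarith [mul_nonneg (sq_nonneg (s - 1)) hs, mul_nonneg (sq_nonneg (s - 1)) (sq_nonneg s)]
  · rw [sqrt_eq_zero_of_nonpos h, abs_le]
    constructor <;> nlinarith

lemma tendsto_sqrt_second_order {R : ℝ → ℝ} {R₀ : ℝ}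
    (hR : Tendsto R (nhdsWithin 0 (Ioi 0)) (nhds R₀)) :
    Tendsto (fun q => (√(1 + q * R q) - 1 - q * R q / 2) / q ^ 2)
      (nhdsWithin 0 (Ioi 0)) (nhds (-R₀ ^ 2 / 8)) := by
  have hq : Tendsto (fun q : ℝ => q) (nhdsWithin 0 (Ioi 0)) (nhds 0) :=
    tendsto_id.mono_left nhdsWithin_le_nhds
  have hw : Tendsto (fun q => 1 + q * R q) (nhdsWithin 0 (Ioi 0)) (nhds 1) := by
    simpa using (hq.mul hR).const_add 1
  have hs : Tendsto (fun q => √(1 + q * R q)) (nhdsWithin 0 (Ioi 0)) (nhds 1) := by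
    simpa using hw.sqrt
  have hl : Tendsto (fun q => -(R q) ^ 2 / (2 * (√(1 + q * R q) + 1) ^ 2))
      (nhdsWithin 0 (Ioi 0)) (nhds (-R₀ ^ 2 / 8)) := by
    have := (hR.pow 2).neg.div (((hs.add_const 1).pow 2).const_mul 2) (by norm_num)
    have h8 : (8 : ℝ) = 2 * (1 + 1) ^ 2 := by norm_num
    rw [h8]
    exact this
  refine hl.congr' ?_
  filter_upwards [self_mem_nhdsWithin, hw.eventually (lt_mem_nhds one_pos)] with q hq0 hpos
  have hq0 : q ≠ 0 := ne_of_gt hq0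
  have hsq := sq_sqrt hpos.le
  set s := √(1 + q * R q) with hsdef
  have hs0 : 0 ≤ s := sqrt_nonneg _
  have hR' : R q = (s ^ 2 - 1) / q := by
    rw [hsq]; field_simp; ring
  rw [hR']
  field_simp
  ring

/-- If `R q` has `g`-mean zero, converges pointwise to `R₀` and is dominated by a function that is
square integrable against the probability density `g`, then
`∫ g √(1 + q R q) = 1 - (∫ g R₀²) q² / 8 + o(q²)` as `q → 0⁺`. -/
lemma tendsto_integral_sqrt_expansion {X : Type*} [MeasurableSpace X] {μ : Measure X}
    {g b R₀ : X → ℝ} {R : ℝ → X → ℝ} (hg : ∀ᵐ x ∂μ, 0 ≤ g x) (hgi : Integrable g μ)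
    (hg1 : ∫ x, g x ∂μ = 1)
    (hRm : ∀ᶠ q in nhdsWithin 0 (Ioi 0), AEStronglyMeasurable (R q) μ)
    (hRi : ∀ᶠ q in nhdsWithin 0 (Ioi 0), Integrable (fun x => g x * R q x) μ)
    (hR0 : ∀ᶠ q in nhdsWithin 0 (Ioi 0), ∫ x, g x * R q x ∂μ = 0)
    (hb : ∀ᶠ q in nhdsWithin 0 (Ioi 0), ∀ᵐ x ∂μ, |R q x| ≤ b x)
    (hbi : Integrable (fun x => g x * b x ^ 2) μ)
    (hlim : ∀ᵐ x ∂μ, Tendsto (fun q => R q x) (nhdsWithin 0 (Ioi 0)) (nhds (R₀ x))) :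
    Tendsto (fun q : ℝ => ((∫ x, g x * √(1 + q * R q x) ∂μ) - 1
        - (∫ x, g x * (-R₀ x ^ 2 / 8) ∂μ) * q ^ 2) / q ^ 2)
      (nhdsWithin 0 (Ioi 0)) (nhds 0) := by
  set ψ : ℝ → X → ℝ := fun q x => (√(1 + q * R q x) - 1 - q * R q x / 2) / q ^ 2 with hψ
  have hψm : ∀ᶠ q in nhdsWithin 0 (Ioi 0), AEStronglyMeasurable (fun x => g x * ψ q x) μ := by
    filter_upwards [hRm] with q hq
    have h1 : AEStronglyMeasurable (fun x => √(1 + q * R q x)) μ :=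
      Real.continuous_sqrt.comp_aestronglyMeasurable ((hq.const_mul q).const_add 1)
    refine hgi.1.mul ?_
    simp only [hψ, div_eq_mul_inv]
    exact (((h1.sub aestronglyMeasurable_const).sub ((hq.const_mul q).mul_const _)).mul_const _)
  have hψb : ∀ᶠ q in nhdsWithin 0 (Ioi 0), ∀ᵐ x ∂μ, ‖g x * ψ q x‖ ≤ 2 * (g x * b x ^ 2) := by
    filter_upwards [hb, self_mem_nhdsWithin] with q hq hq0
    filter_upwards [hq, hg] with x hx hgx
    have hq0 : 0 < q ^ 2 := pow_pos hq0 2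
    have h1 := abs_sqrt_sub_le (1 + q * R q x)
    have h2 : R q x ^ 2 ≤ b x ^ 2 := by
      rw [← sq_abs]; exact pow_le_pow_left₀ (abs_nonneg _) hx 2
    have h3 : |ψ q x| ≤ 2 * b x ^ 2 := by
      simp only [hψ]
      rw [abs_div, abs_of_pos hq0, div_le_iff₀ hq0]
      rw [add_sub_cancel_left] at h1
      nlinarith
    rw [norm_mul, Real.norm_eq_abs, Real.norm_eq_abs, abs_of_nonneg hgx]
    nlinarith
  have hlim' := tendsto_integral_filter_of_dominated_convergence
    (F := fun q x => g x * ψ q x) (f := fun x => g x * (-R₀ x ^ 2 / 8)) _ hψm hψb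
    (hbi.const_mul 2)
    (hlim.mono fun x hx => (tendsto_sqrt_second_order hx).const_mul (g x))
  have hlim0 := hlim'.sub_const (∫ x, g x * (-R₀ x ^ 2 / 8) ∂μ)
  rw [sub_self] at hlim0
  refine hlim0.congr' ?_
  filter_upwards [hRi, hR0, hψm, hψb, self_mem_nhdsWithin] with q hi h0 hm hbd hq0
  have hq0 : q ≠ 0 := ne_of_gt hq0
  have hψi : Integrable (fun x => g x * ψ q x) μ := (hbi.const_mul 2).mono' hm hbd
  have key : ∫ x, g x * √(1 + q * R q x) ∂μ = 1 + q ^ 2 * ∫ x, g x * ψ q x ∂μ := by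
    have : ∀ x, g x * √(1 + q * R q x)
        = g x + (q / 2) * (g x * R q x) + q ^ 2 * (g x * ψ q x) := by
      intro x
      simp only [hψ]
      field_simp
      ring
    simp_rw [this]
    rw [integral_add (hgi.fun_add (hi.const_mul _)) (hψi.const_mul _),
      integral_add hgi (hi.const_mul _), integral_const_mul, integral_const_mul, h0, hg1]
    ring
  rw [key]
  field_simp
  ring

/-- The ratio `(g₁*h_s)/g₁`. -/
noncomputable def convRatio (μ₁ μ₂ : ℝ) (s : ℕ) (x : ℝ) : ℝ :=
  convExpErlang μ₁ μ₂ s x / (μ₁ * Real.exp (-μ₁ * x))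

lemma continuous_erlangDensity (μ₂ : ℝ) (s : ℕ) : Continuous (erlangDensity μ₂ s) := by
  unfold erlangDensity
  fun_prop

lemma convRatio_eq_integral {μ₁ : ℝ} (hμ₁ : μ₁ ≠ 0) (μ₂ : ℝ) (s : ℕ) (x : ℝ) :
    convRatio μ₁ μ₂ s x = ∫ t in (0 : ℝ)..x, Real.exp (μ₁ * t) * erlangDensity μ₂ s t := by
  have h := intervalIntegral.integral_comp_sub_left (a := 0) (b := x)
    (fun t => Real.exp (μ₁ * t) * erlangDensity μ₂ s t) x
  rw [sub_self, sub_zero] at h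
  rw [← h, convRatio, convExpErlang, ← intervalIntegral.integral_div]
  congr 1 with u
  have : Real.exp (μ₁ * (x - u)) = Real.exp (-μ₁ * u) / Real.exp (-μ₁ * x) := by
    rw [← Real.exp_sub]; congr 1; ring
  rw [this]
  field_simp

lemma continuous_convRatio {μ₁ : ℝ} (hμ₁ : μ₁ ≠ 0) (μ₂ : ℝ) (s : ℕ) :
    Continuous (convRatio μ₁ μ₂ s) := by
  rw [funext (convRatio_eq_integral hμ₁ μ₂ s)]
  have hc := continuous_erlangDensity μ₂ s
  exact intervalIntegral.continuous_primitive (fun a b =>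
    Continuous.intervalIntegrable (by fun_prop) a b) 0

/-- `(g₁*h_s)/g₁` grows at most like `e^{κx}` for every `κ > max(0, μ₁ - μ₂)`. -/
lemma exists_abs_convRatio_le {μ₁ μ₂ κ : ℝ} (hμ₁ : 0 < μ₁) (hμ₂ : 0 < μ₂) (hκ : 0 < κ)
    (hκ' : μ₁ - μ₂ < κ) (s : ℕ) :
    ∃ C, ∀ x, 0 ≤ x → |convRatio μ₁ μ₂ s x| ≤ C * Real.exp (κ * x) := by
  set δ := κ - (μ₁ - μ₂) with hδ
  have hδ0 : 0 < δ := by linarith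
  set C := μ₂ ^ s / δ ^ (s - 1) with hC
  have hC0 : 0 ≤ C := by positivity
  refine ⟨C / κ, fun x hx => ?_⟩
  have hbound : ∀ t, 0 ≤ t → |Real.exp (μ₁ * t) * erlangDensity μ₂ s t| ≤ C * Real.exp (κ * t) := by
    intro t ht
    have h1 := Real.pow_div_factorial_le_exp _ (mul_nonneg hδ0.le ht) (s - 1)
    have h2 : Real.exp (κ * t) = Real.exp (μ₁ * t) * Real.exp (-μ₂ * t) * Real.exp (δ * t) := by
      rw [← Real.exp_add, ← Real.exp_add]; congr 1; rw [hδ]; ring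
    have h3 : Real.exp (μ₁ * t) * erlangDensity μ₂ s t
        = C * (Real.exp (μ₁ * t) * Real.exp (-μ₂ * t)
          * ((δ * t) ^ (s - 1) / (Nat.factorial (s - 1)))) := by
      rw [erlangDensity, hC, mul_pow]
      field_simp
    rw [abs_of_nonneg (by rw [h3]; positivity), h3, h2]
    gcongr
  have hi : ∫ t in (0 : ℝ)..x, C * Real.exp (κ * t) = C * ((Real.exp (κ * x) - 1) / κ) := by
    rw [intervalIntegral.integral_const_mul, intervalIntegral.integral_comp_mul_left _ hκ.ne']
    rw [integral_exp, mul_zero, Real.exp_zero, smul_eq_mul, inv_mul_eq_div]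
  rw [convRatio_eq_integral hμ₁.ne', ← Real.norm_eq_abs]
  calc _ ≤ ∫ t in (0 : ℝ)..x, C * Real.exp (κ * t) :=
        intervalIntegral.norm_integral_le_of_norm_le hx
          (ae_of_all _ fun t ht => hbound t ht.1.le)
          (Continuous.intervalIntegrable (by fun_prop) _ _)
    _ ≤ _ := by
        rw [hi, ← mul_div_assoc, div_mul_eq_mul_div C]
        exact div_le_div_of_nonneg_right
          (mul_le_mul_of_nonneg_left (sub_le_self _ zero_le_one) hC0) hκ.le

lemma integral_erlangDensity {μ₂ : ℝ} (hμ₂ : 0 < μ₂) {s : ℕ} (hs : 1 ≤ s) :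
    IntegrableOn (erlangDensity μ₂ s) (Ioi 0) ∧ ∫ x in Ioi (0 : ℝ), erlangDensity μ₂ s x = 1 := by
  obtain ⟨n, rfl⟩ : ∃ n, s = n + 1 := ⟨s - 1, by omega⟩
  have h := Real.integral_rpow_mul_exp_neg_mul_Ioi (a := (n : ℝ) + 1) (by positivity) hμ₂
  have heq : ∀ x, erlangDensity μ₂ (n + 1) x = μ₂ ^ (n + 1) / (Nat.factorial n)
      * (x ^ ((n : ℝ) + 1 - 1) * Real.exp (-(μ₂ * x))) := by
    intro x
    rw [erlangDensity, Nat.add_sub_cancel, add_sub_cancel_right, Real.rpow_natCast, neg_mul]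
    ring
  have h1 : ∫ x in Ioi (0 : ℝ), erlangDensity μ₂ (n + 1) x = 1 := by
    simp_rw [heq]
    rw [integral_const_mul, h, Real.Gamma_nat_eq_factorial, ← Nat.cast_succ, Real.rpow_natCast]
    have := Nat.factorial_ne_zero n
    rw [one_div, inv_pow]
    field_simp
  exact ⟨not_imp_comm.1 integral_undef (by rw [h1]; exact one_ne_zero), h1⟩

lemma integral_exponentialDensity {μ₁ : ℝ} (hμ₁ : 0 < μ₁) :
    IntegrableOn (fun x => μ₁ * Real.exp (-μ₁ * x)) (Ioi 0) ∧
      ∫ x in Ioi (0 : ℝ), μ₁ * Real.exp (-μ₁ * x) = 1 := by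
  refine ⟨(integrableOn_exp_mul_Ioi (neg_lt_zero.2 hμ₁) 0).const_mul μ₁, ?_⟩
  rw [integral_const_mul, integral_exp_mul_Ioi (neg_lt_zero.2 hμ₁)]
  simp [hμ₁.ne']

lemma integral_mul_convRatio {μ₁ μ₂ : ℝ} (hμ₁ : 0 < μ₁) (hμ₂ : 0 < μ₂) {s : ℕ} (hs : 1 ≤ s) :
    IntegrableOn (fun x => μ₁ * Real.exp (-μ₁ * x) * convRatio μ₁ μ₂ s x) (Ioi 0) ∧
      ∫ x in Ioi (0 : ℝ), μ₁ * Real.exp (-μ₁ * x) * convRatio μ₁ μ₂ s x = 1 := by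
  have h := integral_posConvolution (integral_exponentialDensity hμ₁).1
    (integral_erlangDensity hμ₂ hs).1 (ContinuousLinearMap.mul ℝ ℝ)
  have heq : ∀ x, μ₁ * Real.exp (-μ₁ * x) * convRatio μ₁ μ₂ s x = convExpErlang μ₁ μ₂ s x := by
    intro x
    rw [convRatio]
    field_simp
  have h1 : ∫ x in Ioi (0 : ℝ), μ₁ * Real.exp (-μ₁ * x) * convRatio μ₁ μ₂ s x = 1 := by
    simp_rw [heq]
    rw [(integral_exponentialDensity hμ₁).2, (integral_erlangDensity hμ₂ hs).2] at h
    simpa [convExpErlang] using h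
  exact ⟨not_imp_comm.1 integral_undef (by rw [h1]; exact one_ne_zero), h1⟩

lemma geom_tail_sum (z : ℝ) (S : ℕ) (Q : ℕ → ℝ) :
    z * ((1 - z) * ∑ s ∈ Finset.Icc 2 S, ∑ l ∈ Finset.Icc s S, Q l * z ^ (l - s))
      = z * (∑ l ∈ Finset.range (S + 1), Q l - Q 0) - (genQ S Q z - Q 0) := by
  have hgeom : ∀ n : ℕ, (1 - z) * ∑ s ∈ Finset.Icc 2 (n + 1), z ^ (n + 1 - s) = 1 - z ^ n := by
    intro n
    induction n with
    | zero => simp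
    | succ n ih =>
      rw [Finset.sum_Icc_succ_top (by omega)]
      have : ∑ s ∈ Finset.Icc 2 (n + 1), z ^ (n + 1 + 1 - s)
          = z * ∑ s ∈ Finset.Icc 2 (n + 1), z ^ (n + 1 - s) := by
        rw [Finset.mul_sum]
        refine Finset.sum_congr rfl fun s hs => ?_
        rw [Finset.mem_Icc] at hs
        rw [← pow_succ']
        congr 1
        omega
      rw [this, mul_add, mul_left_comm, ih]
      simp
      ring
  induction S with
  | zero => simp [genQ]
  | succ n ih =>
    have hsplit : ∑ s ∈ Finset.Icc 2 (n + 1), ∑ l ∈ Finset.Icc s (n + 1), Q l * z ^ (l - s)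
        = ∑ s ∈ Finset.Icc 2 n, ∑ l ∈ Finset.Icc s n, Q l * z ^ (l - s)
          + Q (n + 1) * ∑ s ∈ Finset.Icc 2 (n + 1), z ^ (n + 1 - s) := by
      have h1 : ∀ s ∈ Finset.Icc 2 (n + 1), ∑ l ∈ Finset.Icc s (n + 1), Q l * z ^ (l - s)
          = ∑ l ∈ Finset.Icc s n, Q l * z ^ (l - s) + Q (n + 1) * z ^ (n + 1 - s) := by
        intro s hs
        exact Finset.sum_Icc_succ_top (Finset.mem_Icc.1 hs).2 _
      rw [Finset.sum_congr rfl h1, Finset.sum_add_distrib, Finset.mul_sum]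
      congr 1
      refine (Finset.sum_subset (Finset.Icc_subset_Icc_right n.le_succ) fun s hs hs' => ?_).symm
      rw [Finset.mem_Icc] at hs hs'
      rw [Finset.Icc_eq_empty (by omega), Finset.sum_empty]
    have hG : genQ (n + 1) Q z = genQ n Q z + z ^ (n + 1) * Q (n + 1) :=
      Finset.sum_range_succ _ _
    rw [hsplit, hG, Finset.sum_range_succ _ (n + 1)]
    linear_combination ih + z * Q (n + 1) * hgeom n

lemma integral_mul_sum_convRatio {μ₁ μ₂ : ℝ} (hμ₁ : 0 < μ₁) (hμ₂ : 0 < μ₂) {t : Finset ℕ}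
    (ht : ∀ s ∈ t, 1 ≤ s) (c : ℕ → ℝ) :
    IntegrableOn (fun x => μ₁ * Real.exp (-μ₁ * x) * ∑ s ∈ t, convRatio μ₁ μ₂ s x * c s) (Ioi 0) ∧
      ∫ x in Ioi (0 : ℝ), μ₁ * Real.exp (-μ₁ * x) * ∑ s ∈ t, convRatio μ₁ μ₂ s x * c s
        = ∑ s ∈ t, c s := by
  simp_rw [Finset.mul_sum, ← mul_assoc]
  have hi : ∀ s ∈ t, IntegrableOn
      (fun x => μ₁ * Real.exp (-μ₁ * x) * convRatio μ₁ μ₂ s x * c s) (Ioi 0) :=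
    fun s hs => (integral_mul_convRatio hμ₁ hμ₂ (ht s hs)).1.mul_const _
  refine ⟨integrable_finsetSum _ hi, ?_⟩
  rw [integral_finsetSum _ hi]
  refine Finset.sum_congr rfl fun s hs => ?_
  rw [integral_mul_const, (integral_mul_convRatio hμ₁ hμ₂ (ht s hs)).2, one_mul]

lemma isBigO_sum_convRatio {μ₁ μ₂ κ : ℝ} (hμ₁ : 0 < μ₁) (hμ₂ : 0 < μ₂) (hκ : 0 < κ)
    (hκ' : μ₁ - μ₂ < κ) (t : Finset ℕ) (c : ℕ → ℝ) :
    (fun x => ∑ s ∈ t, convRatio μ₁ μ₂ s x * c s) =O[𝓟 (Ici 0)] fun x => Real.exp (κ * x) := by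
  refine Asymptotics.IsBigO.fun_sum fun s _ => ?_
  simp_rw [mul_comm _ (c s)]
  refine Asymptotics.IsBigO.const_mul_left ?_ _
  obtain ⟨C, hC⟩ := exists_abs_convRatio_le hμ₁ hμ₂ hκ hκ' s
  refine Asymptotics.isBigO_principal.2 ⟨C, fun x hx => ?_⟩
  rw [Real.norm_of_nonneg (Real.exp_nonneg _)]
  exact hC x hx

lemma Phi1_eq (lam μ₁ μ₂ πJ x : ℝ) :
    Phi1 lam μ₁ μ₂ πJ x = ∑ s ∈ {1}, convRatio μ₁ μ₂ s x * (lam / (lam + μ₂) * πJ) := by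
  rw [Finset.sum_singleton, Phi1, convRatio, mul_comm]

lemma Phi2_eq (lam μ₁ μ₂ πJ : ℝ) {S : ℕ} (hS : 1 ≤ S) (Q : ℕ → ℝ) (x : ℝ) :
    Phi2 lam μ₁ μ₂ πJ S Q x = ∑ s ∈ Finset.Icc 1 S, convRatio μ₁ μ₂ s x *
      ((if 2 ≤ s then lam / (lam + μ₂) * πJ *
        ∑ l ∈ Finset.Icc s S, Q l * (1 - lam / (lam + μ₂)) ^ (l - s) else 0)
        + (1 - πJ) * Q s) := by
  have hsplit := Finset.add_sum_Ioc_eq_sum_Icc (f := fun s => convRatio μ₁ μ₂ s x *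
      (if 2 ≤ s then lam / (lam + μ₂) * πJ *
        ∑ l ∈ Finset.Icc s S, Q l * (1 - lam / (lam + μ₂)) ^ (l - s) else 0)) hS
  simp_rw [mul_add, Finset.sum_add_distrib]
  rw [← hsplit]
  have hI : Finset.Ioc 1 S = Finset.Icc 2 S := by
    ext; simp; omega
  rw [hI, Phi2, Finset.mul_sum, Finset.mul_sum]
  simp only [Nat.not_ofNat_le_one, if_false, mul_zero, zero_add]
  congr 1
  · refine Finset.sum_congr rfl fun s hs => ?_
    rw [if_pos (Finset.mem_Icc.1 hs).1, convRatio]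
    ring
  · refine Finset.sum_congr rfl fun s _ => ?_
    rw [convRatio]
    ring

/-- The difference quotient of `Delta1` at `q = 0`. -/
noncomputable def Delta1Quot (lam μ₂ πJ : ℝ) (S : ℕ) (Q : ℕ → ℝ) (q : ℝ) : ℝ :=
  πJ * (q - 2 + (1 - lam / (lam + μ₂)) + (1 - q) * genQ S Q (1 - lam / (lam + μ₂)))
    / (1 - q * (1 - lam / (lam + μ₂))) - (1 - Q 0) * (1 - πJ)

/-- The difference quotient of `Delta2` at `q = 0`. -/
noncomputable def Delta2Quot (lam μ₂ : ℝ) (S : ℕ) (Q : ℕ → ℝ) (q : ℝ) : ℝ :=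
  ((1 - lam / (lam + μ₂)) * (1 - q * (1 - Q 0))
        + genQ S Q (1 - lam / (lam + μ₂)) - Q 0)
    / ((1 - lam / (lam + μ₂)) * (1 - q * (1 - lam / (lam + μ₂))))

/-- `(W(q,x) - 1)/q`. -/
noncomputable def WQuot (lam μ₁ μ₂ πJ : ℝ) (S : ℕ) (Q : ℕ → ℝ) (q x : ℝ) : ℝ :=
  Delta1Quot lam μ₂ πJ S Q q + Delta2Quot lam μ₂ S Q q * Phi1 lam μ₁ μ₂ πJ x
    + Phi2 lam μ₁ μ₂ πJ S Q x

lemma Wfun_eq_one_add {lam μ₁ μ₂ πJ : ℝ} {S : ℕ} {Q : ℕ → ℝ} {q : ℝ}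
    (hq : 1 - q * (1 - lam / (lam + μ₂)) ≠ 0) (x : ℝ) :
    Wfun lam μ₁ μ₂ πJ S Q q x = 1 + q * WQuot lam μ₁ μ₂ πJ S Q q x := by
  have h1 : Delta1 lam μ₂ πJ S Q q = 1 + q * Delta1Quot lam μ₂ πJ S Q q := by
    rw [Delta1, Delta1Quot]
    generalize lam / (lam + μ₂) = p at *
    field_simp
    ring
  have h2 : Delta2 lam μ₂ S Q q = q * Delta2Quot lam μ₂ S Q q := by
    rw [Delta2, Delta2Quot, mul_div_assoc]
  rw [Wfun, WQuot, h1, h2]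
  ring

lemma mean_WQuot_eq_zero {lam μ₂ πJ : ℝ} {S : ℕ} (hS : 1 ≤ S) {Q : ℕ → ℝ}
    (hQsum : ∑ s ∈ Finset.range (S + 1), Q s = 1) {q : ℝ}
    (hp : 1 - lam / (lam + μ₂) ≠ 0) (hq : 1 - q * (1 - lam / (lam + μ₂)) ≠ 0) :
    Delta1Quot lam μ₂ πJ S Q q + Delta2Quot lam μ₂ S Q q * (lam / (lam + μ₂) * πJ)
      + ∑ s ∈ Finset.Icc 1 S, ((if 2 ≤ s then lam / (lam + μ₂) * πJ *
        ∑ l ∈ Finset.Icc s S, Q l * (1 - lam / (lam + μ₂)) ^ (l - s) else 0)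
        + (1 - πJ) * Q s) = 0 := by
  have hQ : ∑ s ∈ Finset.Icc 1 S, Q s = 1 - Q 0 := by
    rw [← hQsum, Finset.range_eq_Ico, Finset.sum_eq_sum_Ico_succ_bot (by omega)]
    simp [Finset.Ico_add_one_right_eq_Icc]
  have hI : (Finset.Icc 1 S).filter (fun s => 2 ≤ s) = Finset.Icc 2 S := by
    ext; simp; omega
  have hgeom := geom_tail_sum (1 - lam / (lam + μ₂)) S Q
  rw [hQsum] at hgeom
  rw [Finset.sum_add_distrib, ← Finset.sum_filter, hI, ← Finset.mul_sum, ← Finset.mul_sum, hQ,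
    Delta1Quot, Delta2Quot]
  generalize ∑ s ∈ Finset.Icc 2 S, ∑ l ∈ Finset.Icc s S, Q l * (1 - lam / (lam + μ₂)) ^ (l - s) = T
    at *
  generalize genQ S Q (1 - lam / (lam + μ₂)) = G at *
  obtain ⟨z, hz⟩ : ∃ z, z = 1 - lam / (lam + μ₂) := ⟨_, rfl⟩
  have hpz : lam / (lam + μ₂) = 1 - z := by rw [hz]; ring
  rw [← hz] at hp hq hgeom ⊢
  rw [hpz]
  have hT : (1 - z) * T = (1 - Q 0) - (G - Q 0) / z := by
    field_simp
    linear_combination hgeom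
  have hT' : (1 - z) * πJ * T = πJ * ((1 - Q 0) - (G - Q 0) / z) := by
    rw [← hT]; ring
  rw [hT']
  field_simp
  ring

/-- If `μ₁ < 2μ₂`, then there is a finite constant `c₀` such that,
as `q → 0⁺`, `∫₀^∞ μ₁ e^{−μ₁x} √(W(q,x)) dx = 1 + c₀ q² + o(q²)`. -/
theorem expansion_sqrt_W
    (lam μ₁ μ₂ : ℝ) (hlam : 0 < lam) (hμ₁ : 0 < μ₁) (hμ₂ : 0 < μ₂)
    (hμ : μ₁ < 2 * μ₂)
    (πJ : ℝ) (hπJ : πJ ∈ Set.Icc (0:ℝ) 1)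
    (S : ℕ) (hS : 1 ≤ S)
    (Q : ℕ → ℝ) (hQnonneg : ∀ s ≤ S, 0 ≤ Q s)
    (hQsum : ∑ s ∈ Finset.range (S + 1), Q s = 1) :
    ∃ c₀ : ℝ,
      Filter.Tendsto
        (fun q : ℝ =>
          ((∫ x in Set.Ici (0:ℝ),
              μ₁ * Real.exp (-μ₁ * x) *
                Real.sqrt (Wfun lam μ₁ μ₂ πJ S Q q x))
            - 1 - c₀ * q ^ 2) / q ^ 2)
        (nhdsWithin 0 (Set.Ioi 0)) (nhds 0) := by
  have hp0 : 0 < 1 - lam / (lam + μ₂) := by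
    have : lam / (lam + μ₂) < 1 := (div_lt_one (by positivity)).2 (by linarith)
    linarith
  obtain ⟨κ, hκ, hκ₁, hκ₂⟩ : ∃ κ, 0 < κ ∧ μ₁ - μ₂ < κ ∧ 2 * κ < μ₁ := by
    obtain ⟨κ, h1, h2⟩ := exists_between (show max 0 (μ₁ - μ₂) < μ₁ / 2 from
      max_lt (by linarith) (by linarith))
    exact ⟨κ, (max_lt_iff.1 h1).1, (max_lt_iff.1 h1).2, by linarith⟩
  set p := lam / (lam + μ₂) with hp
  have hqne : ∀ᶠ q in nhdsWithin (0 : ℝ) (Ioi 0), 1 - q * (1 - p) ≠ 0 := by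
    have : Tendsto (fun q : ℝ => 1 - q * (1 - p)) (nhdsWithin 0 (Ioi 0)) (nhds 1) := by
      refine Tendsto.mono_left ?_ nhdsWithin_le_nhds
      exact (by fun_prop : Continuous fun q : ℝ => 1 - q * (1 - p)).tendsto' 0 1 (by simp)
    exact this.eventually_ne one_ne_zero
  have hd1 : Tendsto (Delta1Quot lam μ₂ πJ S Q) (nhdsWithin 0 (Ioi 0))
      (nhds (Delta1Quot lam μ₂ πJ S Q 0)) := by
    refine Tendsto.mono_left (ContinuousAt.tendsto ?_) nhdsWithin_le_nhds
    unfold Delta1Quot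
    refine ContinuousAt.sub (ContinuousAt.div (by fun_prop) (by fun_prop) (by simp)) (by fun_prop)
  have hd2 : Tendsto (Delta2Quot lam μ₂ S Q) (nhdsWithin 0 (Ioi 0))
      (nhds (Delta2Quot lam μ₂ S Q 0)) := by
    refine Tendsto.mono_left (ContinuousAt.tendsto ?_) nhdsWithin_le_nhds
    unfold Delta2Quot
    exact ContinuousAt.div (by fun_prop) (by fun_prop) (by simpa using hp0.ne')
  have hc1 : Continuous (Phi1 lam μ₁ μ₂ πJ) := by
    rw [funext (Phi1_eq lam μ₁ μ₂ πJ)]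
    exact continuous_finsetSum _ fun s _ =>
      (continuous_convRatio hμ₁.ne' μ₂ s).mul continuous_const
  have hc2 : Continuous (Phi2 lam μ₁ μ₂ πJ S Q) := by
    rw [funext (Phi2_eq lam μ₁ μ₂ πJ hS Q)]
    exact continuous_finsetSum _ fun s _ =>
      (continuous_convRatio hμ₁.ne' μ₂ s).mul continuous_const
  obtain ⟨C₁, hC₁⟩ := Asymptotics.isBigO_principal.1
    (isBigO_sum_convRatio hμ₁ hμ₂ hκ hκ₁ {1} fun _ => p * πJ)
  obtain ⟨C₂, hC₂⟩ := Asymptotics.isBigO_principal.1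
    (isBigO_sum_convRatio hμ₁ hμ₂ hκ hκ₁ (Finset.Icc 1 S) fun s =>
      (if 2 ≤ s then p * πJ * ∑ l ∈ Finset.Icc s S, Q l * (1 - p) ^ (l - s) else 0)
        + (1 - πJ) * Q s)
  simp_rw [hp, ← Phi1_eq, Real.norm_eq_abs, Real.abs_exp] at hC₁
  simp_rw [hp, ← Phi2_eq lam μ₁ μ₂ πJ hS, Real.norm_eq_abs, Real.abs_exp] at hC₂
  have hm1 := integral_mul_sum_convRatio hμ₁ hμ₂ (t := {1}) (by simp) fun _ => p * πJ
  have hm2 := integral_mul_sum_convRatio hμ₁ hμ₂ (t := Finset.Icc 1 S)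
    (fun s hs => (Finset.mem_Icc.1 hs).1) fun s =>
      (if 2 ≤ s then p * πJ * ∑ l ∈ Finset.Icc s S, Q l * (1 - p) ^ (l - s) else 0)
        + (1 - πJ) * Q s
  simp_rw [hp, ← Phi1_eq, Finset.sum_singleton] at hm1
  simp_rw [hp, ← Phi2_eq lam μ₁ μ₂ πJ hS] at hm2
  obtain ⟨hg, hg1⟩ := integral_exponentialDensity hμ₁
  have hsplit : ∀ q x, μ₁ * Real.exp (-μ₁ * x) * WQuot lam μ₁ μ₂ πJ S Q q x
      = Delta1Quot lam μ₂ πJ S Q q * (μ₁ * Real.exp (-μ₁ * x))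
        + Delta2Quot lam μ₂ S Q q * (μ₁ * Real.exp (-μ₁ * x) * Phi1 lam μ₁ μ₂ πJ x)
        + μ₁ * Real.exp (-μ₁ * x) * Phi2 lam μ₁ μ₂ πJ S Q x := by
    intro q x
    rw [WQuot]
    ring
  set K := |Delta1Quot lam μ₂ πJ S Q 0| + 1 + (|Delta2Quot lam μ₂ S Q 0| + 1) * C₁ + C₂ with hK
  have key := tendsto_integral_sqrt_expansion (μ := volume.restrict (Ioi (0 : ℝ)))
    (g := fun x => μ₁ * Real.exp (-μ₁ * x)) (b := fun x => K * Real.exp (κ * x))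
    (R := WQuot lam μ₁ μ₂ πJ S Q) (R₀ := WQuot lam μ₁ μ₂ πJ S Q 0)
    (ae_of_all _ fun x => by positivity) hg hg1
    (Eventually.of_forall fun q => by
      have : Continuous (WQuot lam μ₁ μ₂ πJ S Q q) := by
        unfold WQuot
        fun_prop
      exact this.aestronglyMeasurable)
    (Eventually.of_forall fun q => by
      simp_rw [hsplit]
      exact ((hg.const_mul _).add (hm1.1.const_mul _)).add hm2.1)
    (by
      filter_upwards [hqne] with q hq
      simp_rw [hsplit]
      rw [integral_add ((hg.const_mul _).fun_add (hm1.1.const_mul _)) hm2.1,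
        integral_add (hg.const_mul _) (hm1.1.const_mul _),
        integral_const_mul (Delta1Quot _ _ _ _ _ _), integral_const_mul (Delta2Quot _ _ _ _ _),
        hg1, hm1.2, hm2.2, mul_one]
      exact mean_WQuot_eq_zero hS hQsum hp0.ne' hq)
    (by
      filter_upwards [hd1.abs.eventually (gt_mem_nhds (lt_add_one _)),
        hd2.abs.eventually (gt_mem_nhds (lt_add_one _))] with q h1 h2
      filter_upwards [ae_restrict_mem measurableSet_Ioi] with x hx
      have hx0 : (0 : ℝ) ≤ x := le_of_lt hx
      have he : 1 ≤ Real.exp (κ * x) := Real.one_le_exp (by positivity)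
      have hF1 := hC₁ x hx0
      have hF2 := hC₂ x hx0
      have h3 : |Delta2Quot lam μ₂ S Q q * Phi1 lam μ₁ μ₂ πJ x|
          ≤ (|Delta2Quot lam μ₂ S Q 0| + 1) * (C₁ * Real.exp (κ * x)) := by
        rw [abs_mul]
        exact mul_le_mul h2.le hF1 (abs_nonneg _) (by positivity)
      have h4 : |Delta1Quot lam μ₂ πJ S Q q|
          ≤ (|Delta1Quot lam μ₂ πJ S Q 0| + 1) * Real.exp (κ * x) :=
        h1.le.trans (le_mul_of_one_le_right (by positivity) he)
      rw [WQuot]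
      refine (abs_add_three _ _ _).trans ?_
      rw [hK]
      linarith)
    (by
      have h : ∀ x, μ₁ * Real.exp (-μ₁ * x) * (K * Real.exp (κ * x)) ^ 2
          = μ₁ * K ^ 2 * Real.exp ((2 * κ - μ₁) * x) := by
        intro x
        have : Real.exp ((2 * κ - μ₁) * x) = Real.exp (-μ₁ * x) * Real.exp (κ * x) ^ 2 := by
          rw [← Real.exp_nat_mul, ← Real.exp_add]
          congr 1
          push_cast
          ring
        rw [this]
        ring
      simp_rw [h]
      exact (integrableOn_exp_mul_Ioi (by linarith) 0).const_mul _)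
    (ae_of_all _ fun x => (hd1.add (hd2.mul_const _)).add_const _)
  refine ⟨∫ x in Ioi (0 : ℝ), μ₁ * Real.exp (-μ₁ * x) * (-WQuot lam μ₁ μ₂ πJ S Q 0 x ^ 2 / 8),
    key.congr' ?_⟩
  filter_upwards [hqne] with q hq
  simp_rw [integral_Ici_eq_integral_Ioi, Wfun_eq_one_add hq]
end

section
/- Fix μ > 0, λ > 0 and r = 2 (so Ξ(θ,x) = 1 + θ(e^{μx} − 2)), and let φ : ℕ → [8,∞) satisfy limsup_{n→∞} √(n log n)/φ(n) < ∞. Then for every ε > 0 there exists δ₀ ∈ (0,1] such that for every δ ∈ (0,δ₀], liminf_{n→∞} (∫₀^∞ λ e^{−λv} (∫₀^∞ 2μ e^{−2μx} √(Ξ(δe^{−μv}/φ(n), x)) dx) dv)ⁿ ≥ 1 − ε. -/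
open MeasureTheory Real Set Filter

lemma one_add_half_sub_sq_le_sqrt {u : ℝ} (hu : -1 ≤ u) :
    1 + u / 2 - u ^ 2 / 2 ≤ √(1 + u) := by
  rcases le_or_gt u 2 with h | h
  · apply Real.le_sqrt_of_sq_le
    have h0 : 0 ≤ (1 + u) * u ^ 2 * (3 - u) :=
      mul_nonneg (mul_nonneg (by linarith) (sq_nonneg u)) (by linarith)
    nlinarith
  · refine le_trans ?_ (Real.sqrt_nonneg _)
    nlinarith

lemma one_add_half_sub_abs_le_sqrt {u : ℝ} (hu : -1 ≤ u) :
    1 + u / 2 - |u| / 2 ≤ √(1 + u) := by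
  apply Real.le_sqrt_of_sq_le
  rcases le_or_gt 0 u with h | h
  · rw [abs_of_nonneg h]; nlinarith
  · rw [abs_of_neg h]; nlinarith

lemma sqrt_one_add_le_one_add_half {u : ℝ} (hu : -1 ≤ u) : √(1 + u) ≤ 1 + u / 2 := by
  apply Real.sqrt_le_iff.2
  constructor
  · linarith
  · nlinarith [sq_nonneg u]

lemma abs_mul_exp_sub_two_le {θ y : ℝ} (hθ : 0 ≤ θ) (hy : 1 ≤ y) :
    |θ * (y - 2)| ≤ θ * y := by
  rw [abs_le]
  constructor <;> nlinarith

lemma integrableOn_exp_neg_mul_Ioi {a : ℝ} (ha : 0 < a) (c : ℝ) :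
    IntegrableOn (fun x => exp (-a * x)) (Ioi c) :=
  integrableOn_exp_mul_Ioi (by linarith) c

lemma integral_exp_neg_mul_Ioi {a : ℝ} (ha : 0 < a) (c : ℝ) :
    ∫ x in Ioi c, exp (-a * x) = exp (-a * c) / a := by
  rw [integral_exp_mul_Ioi (by linarith) c, neg_div_neg_eq]

section Inner

variable {μ θ : ℝ}

lemma linear_majorant_eq (μ θ x : ℝ) :
    2 * μ * exp (-(2 * μ) * x) * (1 + θ * (exp (μ * x) - 2) / 2) =
      2 * μ * (1 - θ) * exp (-(2 * μ) * x) + μ * θ * exp (-μ * x) := by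
  have : exp (-μ * x) = exp (-(2 * μ) * x) * exp (μ * x) := by
    rw [← exp_add]; ring_nf
  rw [this]; ring

lemma integrableOn_linear_majorant (hμ : 0 < μ) (θ : ℝ) :
    IntegrableOn (fun x => 2 * μ * exp (-(2 * μ) * x) * (1 + θ * (exp (μ * x) - 2) / 2))
      (Ioi 0) := by
  simp_rw [linear_majorant_eq]
  exact ((integrableOn_exp_neg_mul_Ioi (by positivity) 0).const_mul _).add
    ((integrableOn_exp_neg_mul_Ioi hμ 0).const_mul _)

lemma integral_linear_majorant (hμ : 0 < μ) (θ : ℝ) :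
    ∫ x in Ioi (0 : ℝ), 2 * μ * exp (-(2 * μ) * x) * (1 + θ * (exp (μ * x) - 2) / 2) = 1 := by
  simp_rw [linear_majorant_eq]
  rw [integral_add ((integrableOn_exp_neg_mul_Ioi (by positivity) 0).const_mul _)
    ((integrableOn_exp_neg_mul_Ioi hμ 0).const_mul _), integral_const_mul, integral_const_mul,
    integral_exp_neg_mul_Ioi (by positivity), integral_exp_neg_mul_Ioi hμ]
  simp only [mul_zero, exp_zero]
  field_simp
  ring

lemma neg_one_le_mul_exp_sub_two (hμ : 0 < μ) (h0 : 0 ≤ θ) (h1 : θ ≤ 1) {x : ℝ} (hx : 0 < x) :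
    -1 ≤ θ * (exp (μ * x) - 2) := by
  have : 1 ≤ exp (μ * x) := one_le_exp (by positivity)
  nlinarith

lemma sqrt_integrand_le_linear_majorant (hμ : 0 < μ) (h0 : 0 ≤ θ) (h1 : θ ≤ 1) {x : ℝ}
    (hx : 0 < x) :
    2 * μ * exp (-(2 * μ) * x) * √(1 + θ * (exp (μ * x) - 2)) ≤
      2 * μ * exp (-(2 * μ) * x) * (1 + θ * (exp (μ * x) - 2) / 2) := by
  gcongr
  exact sqrt_one_add_le_one_add_half (neg_one_le_mul_exp_sub_two hμ h0 h1 hx)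

lemma integrableOn_sqrt_integrand (hμ : 0 < μ) (h0 : 0 ≤ θ) (h1 : θ ≤ 1) :
    IntegrableOn (fun x => 2 * μ * exp (-(2 * μ) * x) * √(1 + θ * (exp (μ * x) - 2)))
      (Ioi 0) := by
  refine (integrableOn_linear_majorant hμ θ).mono'
    (by fun_prop : Continuous _).aestronglyMeasurable ?_
  filter_upwards [ae_restrict_mem measurableSet_Ioi] with x hx
  rw [norm_of_nonneg (by positivity)]
  exact sqrt_integrand_le_linear_majorant hμ h0 h1 hx

lemma integral_sqrt_integrand_le_one (hμ : 0 < μ) (h0 : 0 ≤ θ) (h1 : θ ≤ 1) :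
    ∫ x in Ici (0 : ℝ), 2 * μ * exp (-(2 * μ) * x) * √(1 + θ * (exp (μ * x) - 2)) ≤ 1 := by
  rw [integral_Ici_eq_integral_Ioi]
  refine le_of_le_of_eq ?_ (integral_linear_majorant hμ θ)
  exact setIntegral_mono_on (integrableOn_sqrt_integrand hμ h0 h1)
    (integrableOn_linear_majorant hμ θ) measurableSet_Ioi
    fun x hx => sqrt_integrand_le_linear_majorant hμ h0 h1 hx

/-- Truncating at level `K`, the quadratic error of the square root costs `θ² log K` below the
level, and the linear error costs `θ / K` above it. -/
lemma one_sub_le_integral_sqrt_integrand (hμ : 0 < μ) (h0 : 0 ≤ θ) (h1 : θ ≤ 1) {K : ℝ}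
    (hK : 1 ≤ K) :
    1 - (θ ^ 2 * log K + θ / K) ≤
      ∫ x in Ici (0 : ℝ), 2 * μ * exp (-(2 * μ) * x) * √(1 + θ * (exp (μ * x) - 2)) := by
  rw [integral_Ici_eq_integral_Ioi]
  have hK0 : 0 < K := by linarith
  set L := log K / μ with hL
  have hL0 : 0 ≤ L := div_nonneg (log_nonneg hK) hμ.le
  set f := fun x => 2 * μ * exp (-(2 * μ) * x) * √(1 + θ * (exp (μ * x) - 2)) with hf
  set b := fun x => 2 * μ * exp (-(2 * μ) * x) * (1 + θ * (exp (μ * x) - 2) / 2) with hb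
  have hfi : IntegrableOn f (Ioi 0) := integrableOn_sqrt_integrand hμ h0 h1
  have hbi : IntegrableOn b (Ioi 0) := integrableOn_linear_majorant hμ θ
  have hdi : IntegrableOn (fun x => b x - f x) (Ioi 0) := hbi.sub hfi
  have hsub : ∫ x in Ioi 0, (b x - f x) = 1 - ∫ x in Ioi 0, f x := by
    rw [integral_sub hbi hfi, integral_linear_majorant hμ θ]
  have hdL : IntegrableOn (fun x => b x - f x) (Ioc 0 L) := hdi.mono_set Ioc_subset_Ioi_self
  have hdR : IntegrableOn (fun x => b x - f x) (Ioi L) := hdi.mono_set (Ioi_subset_Ioi hL0)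
  have hsplit : ∫ x in Ioi 0, (b x - f x) =
      (∫ x in Ioc 0 L, (b x - f x)) + ∫ x in Ioi L, (b x - f x) := by
    rw [← Ioc_union_Ioi_eq_Ioi hL0]
    exact setIntegral_union (Ioc_disjoint_Ioi le_rfl) measurableSet_Ioi hdL hdR
  have habs {x : ℝ} (hx : 0 < x) : |θ * (exp (μ * x) - 2)| ≤ θ * exp (μ * x) :=
    abs_mul_exp_sub_two_le h0 (one_le_exp (by positivity))
  have hleft : ∫ x in Ioc 0 L, (b x - f x) ≤ θ ^ 2 * log K := by
    calc ∫ x in Ioc 0 L, (b x - f x) ≤ ∫ x in Ioc 0 L, μ * θ ^ 2 := by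
          refine setIntegral_mono_on hdL (integrableOn_const measure_Ioc_lt_top.ne) measurableSet_Ioc fun x hx => ?_
          have hu := neg_one_le_mul_exp_sub_two hμ h0 h1 hx.1
          have hs := one_add_half_sub_sq_le_sqrt hu
          have h2 : (θ * (exp (μ * x) - 2)) ^ 2 ≤ (θ * exp (μ * x)) ^ 2 :=
            sq_le_sq' (abs_le.1 (habs hx.1)).1 (abs_le.1 (habs hx.1)).2
          have he : exp (-(2 * μ) * x) * exp (μ * x) ^ 2 = 1 := by
            rw [sq, ← exp_add, ← exp_add, ← exp_zero]; ring_nf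
          calc b x - f x = 2 * μ * exp (-(2 * μ) * x) *
                (1 + θ * (exp (μ * x) - 2) / 2 - √(1 + θ * (exp (μ * x) - 2))) := by
                simp only [hb, hf]; ring
            _ ≤ 2 * μ * exp (-(2 * μ) * x) * ((θ * exp (μ * x)) ^ 2 / 2) := by
                gcongr; linarith
            _ = μ * θ ^ 2 * (exp (-(2 * μ) * x) * exp (μ * x) ^ 2) := by ring
            _ = μ * θ ^ 2 := by rw [he, mul_one]
      _ = θ ^ 2 * log K := by
          rw [setIntegral_const, Real.volume_real_Ioc_of_le hL0, hL, smul_eq_mul]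
          field_simp
          ring
  have hright : ∫ x in Ioi L, (b x - f x) ≤ θ / K := by
    calc ∫ x in Ioi L, (b x - f x) ≤ ∫ x in Ioi L, μ * θ * exp (-μ * x) := by
          refine setIntegral_mono_on hdR ((integrableOn_exp_neg_mul_Ioi hμ L).const_mul _)
            measurableSet_Ioi fun x hx => ?_
          have hx0 : 0 < x := hL0.trans_lt hx
          have hu := neg_one_le_mul_exp_sub_two hμ h0 h1 hx0
          have hs := one_add_half_sub_abs_le_sqrt hu
          have he : exp (-(2 * μ) * x) * exp (μ * x) = exp (-μ * x) := by
            rw [← exp_add]; ring_nf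
          calc b x - f x = 2 * μ * exp (-(2 * μ) * x) *
                (1 + θ * (exp (μ * x) - 2) / 2 - √(1 + θ * (exp (μ * x) - 2))) := by
                simp only [hb, hf]; ring
            _ ≤ 2 * μ * exp (-(2 * μ) * x) * (θ * exp (μ * x) / 2) := by
                gcongr; linarith [habs hx0]
            _ = μ * θ * (exp (-(2 * μ) * x) * exp (μ * x)) := by ring
            _ = μ * θ * exp (-μ * x) := by rw [he]
      _ = θ / K := by
          rw [integral_const_mul, integral_exp_neg_mul_Ioi hμ]
          have : -μ * L = -log K := by rw [hL]; field_simp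
          rw [this, exp_neg, exp_log hK0]
          field_simp
  linarith

end Inner

section Outer

variable {μ lam q : ℝ}

lemma integrableOn_outer (hμ : 0 < μ) (hlam : 0 < lam) (h0 : 0 ≤ q) (h1 : q ≤ 1) :
    IntegrableOn (fun v => lam * exp (-lam * v) * ∫ x in Ici (0 : ℝ),
      2 * μ * exp (-(2 * μ) * x) * √(1 + (q * exp (-μ * v)) * (exp (μ * x) - 2))) (Ioi 0) := by
  refine ((integrableOn_exp_neg_mul_Ioi hlam 0).const_mul lam).mono' ?_ ?_
  · refine AEStronglyMeasurable.mul (by fun_prop : Continuous _).aestronglyMeasurable ?_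
    refine StronglyMeasurable.aestronglyMeasurable ?_
    refine StronglyMeasurable.integral_prod_right (f := fun v x : ℝ =>
      2 * μ * exp (-(2 * μ) * x) * √(1 + (q * exp (-μ * v)) * (exp (μ * x) - 2))) ?_
    exact (by fun_prop : Continuous _).stronglyMeasurable
  · filter_upwards [ae_restrict_mem measurableSet_Ioi] with v hv
    have he : exp (-μ * v) ≤ 1 := exp_le_one_iff.2 (by nlinarith [mem_Ioi.1 hv])
    have hq : q * exp (-μ * v) ≤ 1 := mul_le_one₀ h1 (exp_pos _).le he
    have hI : 0 ≤ ∫ x in Ici (0 : ℝ),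
        2 * μ * exp (-(2 * μ) * x) * √(1 + (q * exp (-μ * v)) * (exp (μ * x) - 2)) :=
      integral_nonneg fun x => by positivity
    rw [norm_of_nonneg (by positivity)]
    exact mul_le_of_le_one_right (by positivity)
      (integral_sqrt_integrand_le_one hμ (by positivity) hq)

lemma integral_const_exp (hlam : 0 < lam) (c : ℝ) :
    ∫ v in Ioi (0 : ℝ), lam * exp (-lam * v) * c = c := by
  rw [integral_mul_const, integral_const_mul, integral_exp_neg_mul_Ioi hlam]
  simp [hlam.ne']

lemma outer_nonneg (hμ : 0 < μ) (hlam : 0 < lam) :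
    0 ≤ ∫ v in Ici (0 : ℝ), lam * exp (-lam * v) * ∫ x in Ici (0 : ℝ),
      2 * μ * exp (-(2 * μ) * x) * √(1 + (q * exp (-μ * v)) * (exp (μ * x) - 2)) :=
  integral_nonneg fun v => mul_nonneg (by positivity) (integral_nonneg fun x => by positivity)

lemma outer_le_one (hμ : 0 < μ) (hlam : 0 < lam) (h0 : 0 ≤ q) (h1 : q ≤ 1) :
    ∫ v in Ici (0 : ℝ), lam * exp (-lam * v) * ∫ x in Ici (0 : ℝ),
      2 * μ * exp (-(2 * μ) * x) * √(1 + (q * exp (-μ * v)) * (exp (μ * x) - 2)) ≤ 1 := by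
  rw [integral_Ici_eq_integral_Ioi]
  refine le_of_le_of_eq ?_ (integral_const_exp hlam 1)
  refine setIntegral_mono_on (integrableOn_outer hμ hlam h0 h1)
    (((integrableOn_exp_neg_mul_Ioi hlam 0).const_mul lam).mul_const _) measurableSet_Ioi
    fun v hv => ?_
  have he : exp (-μ * v) ≤ 1 := exp_le_one_iff.2 (by nlinarith [mem_Ioi.1 hv])
  gcongr
  exact integral_sqrt_integrand_le_one hμ (by positivity) (mul_le_one₀ h1 (exp_pos _).le he)

lemma one_sub_le_outer (hμ : 0 < μ) (hlam : 0 < lam) (h0 : 0 ≤ q) (h1 : q ≤ 1) {K : ℝ}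
    (hK : 1 ≤ K) :
    1 - (q ^ 2 * log K + q / K) ≤ ∫ v in Ici (0 : ℝ), lam * exp (-lam * v) *
      ∫ x in Ici (0 : ℝ),
        2 * μ * exp (-(2 * μ) * x) * √(1 + (q * exp (-μ * v)) * (exp (μ * x) - 2)) := by
  rw [integral_Ici_eq_integral_Ioi, ← integral_const_exp hlam (1 - (q ^ 2 * log K + q / K))]
  refine setIntegral_mono_on (((integrableOn_exp_neg_mul_Ioi hlam 0).const_mul lam).mul_const _)
    (integrableOn_outer hμ hlam h0 h1) measurableSet_Ioi fun v hv => ?_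
  have he : exp (-μ * v) ≤ 1 := exp_le_one_iff.2 (by nlinarith [mem_Ioi.1 hv])
  have hlog : 0 ≤ log K := log_nonneg hK
  have hK0 : 0 < K := by linarith
  have hq : q * exp (-μ * v) ≤ q := mul_le_of_le_one_right h0 he
  have hinner := one_sub_le_integral_sqrt_integrand hμ
    (by positivity : 0 ≤ q * exp (-μ * v)) (hq.trans h1) hK
  gcongr
  refine le_trans ?_ hinner
  gcongr

end Outer

/-- For `μ, λ > 0`, `r = 2` (so `Ξ(θ,x) = 1 + θ(e^{μx} − 2)`),
and `φ : ℕ → [8,∞)` with `limsup √(n log n)/φ(n) < ∞` (i.e. the sequence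
`√(n log n)/φ(n)` is eventually bounded above), for every `ε > 0` there is
`δ₀ ∈ (0,1]` such that for every `δ ∈ (0,δ₀]`,
`liminf_n (∫₀^∞ λe^{−λv} ∫₀^∞ 2μe^{−2μx} √Ξ(δe^{−μv}/φ(n),x) dx dv)ⁿ ≥ 1 − ε`. -/
theorem affinity_power_liminf_ge_r_eq_two
    (μ lam : ℝ) (hμ : 0 < μ) (hlam : 0 < lam)
    (φ : ℕ → ℝ) (hφ : ∀ n, 8 ≤ φ n)
    (hbdd : Filter.IsBoundedUnder (· ≤ ·) Filter.atTop
      (fun n : ℕ => Real.sqrt ((n : ℝ) * Real.log n) / φ n)) :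
    ∀ ε : ℝ, 0 < ε →
      ∃ δ₀ : ℝ, 0 < δ₀ ∧ δ₀ ≤ 1 ∧
        ∀ δ : ℝ, 0 < δ → δ ≤ δ₀ →
          1 - ε ≤ Filter.liminf
            (fun n : ℕ =>
              (∫ v in Set.Ici (0:ℝ),
                  lam * Real.exp (-lam * v) *
                    ∫ x in Set.Ici (0:ℝ),
                      2 * μ * Real.exp (-(2 * μ) * x) *
                        Real.sqrt (1 + (δ * Real.exp (-μ * v) / φ n) *
                          (Real.exp (μ * x) - 2))) ^ n)
            Filter.atTop := by
  intro ε hε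
  obtain ⟨C, hC⟩ := hbdd
  rw [eventually_map] at hC
  refine ⟨min 1 (ε / (C ^ 2 + 1)), by positivity, min_le_left _ _, fun δ hδ hδ₀ => ?_⟩
  have hδ1 : δ ≤ 1 := hδ₀.trans (min_le_left _ _)
  have hδε : δ * (C ^ 2 + 1) ≤ ε :=
    (le_div_iff₀ (by positivity)).1 (hδ₀.trans (min_le_right _ _))
  simp_rw [mul_div_right_comm δ]
  have hq0 (n : ℕ) : 0 ≤ δ / φ n := div_nonneg hδ.le (by linarith [hφ n])
  have hq1 (n : ℕ) : δ / φ n ≤ 1 := (div_le_one (by linarith [hφ n])).2 (by linarith [hφ n])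
  refine le_liminf_of_le (IsBoundedUnder.isCoboundedUnder_ge ⟨1, ?_⟩) ?_
  · exact eventually_map.2 (Eventually.of_forall fun n =>
      pow_le_one₀ (outer_nonneg hμ hlam) (outer_le_one hμ hlam (hq0 n) (hq1 n)))
  · filter_upwards [hC, eventually_ge_atTop 1] with n hCn hn
    have hn1 : (1 : ℝ) ≤ n := by exact_mod_cast hn
    have hφn := hφ n
    have hφ0 : 0 < φ n := by linarith
    have hJ := one_sub_le_outer hμ hlam (hq0 n) (hq1 n) hn1
    have hJ0 := outer_nonneg (q := δ / φ n) hμ hlam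
    set J := ∫ v in Ici (0 : ℝ), lam * exp (-lam * v) * ∫ x in Ici (0 : ℝ),
      2 * μ * exp (-(2 * μ) * x) * √(1 + (δ / φ n * exp (-μ * v)) * (exp (μ * x) - 2))
    have hnl : 0 ≤ (n : ℝ) * log n := mul_nonneg (by linarith) (log_nonneg hn1)
    have hsq : (n : ℝ) * log n / φ n ^ 2 ≤ C ^ 2 := by
      rw [← Real.sq_sqrt hnl, ← div_pow]
      exact pow_le_pow_left₀ (by positivity) hCn 2
    have hber := one_add_mul_le_pow (a := J - 1) (by linarith) n
    rw [add_sub_cancel] at hber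
    have hδC : δ ^ 2 * ((n : ℝ) * log n / φ n ^ 2) ≤ δ * C ^ 2 := by
      have : δ ^ 2 ≤ δ := by nlinarith
      exact mul_le_mul this hsq (by positivity) hδ.le
    have hδφ : δ / φ n ≤ δ := div_le_self hδ.le (by linarith)
    have hmul : (n : ℝ) * (1 - J) ≤ n * ((δ / φ n) ^ 2 * log n + δ / φ n / n) := by
      gcongr; linarith
    have heq : (n : ℝ) * ((δ / φ n) ^ 2 * log n + δ / φ n / n) =
        δ ^ 2 * ((n : ℝ) * log n / φ n ^ 2) + δ / φ n := by
      field_simp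
    linarith
end
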